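/- For each fixed odd positive integer j, with λ_j(n) = −(1/2)·Σ_{l=0}^{n−1} D_{0l}² e^{2πilj/n} the j-th eigenvalue of the double-centered matrix B of n evenly spaced points on the geodesic circle, and with u_j(n) = (cos(2πjl/n))_{l=0}^{n−1}, v_j(n) = (sin(2πjl/n))_{l=0}^{n−1}, the MDS coordinate amplitudes a_j(n) = √(λ_j(n))/‖u_j(n)‖ and b_j(n) = √(λ_j(n))/‖v_j(n)‖ satisfy lim_{n→∞} a_j(n) = √2/j and lim_{n→∞} b_j(n) = √2/j. Consequently the classical MDS embedding of S¹_n into ℝ^m lies, up to a rigid motion, on the curve γ_m(θ) = (a_1(n)cos θ, a_1(n)sin θ, a_3(n)cos 3θ, a_3(n)sin 3θ, a_5(n)cos 5θ, …) ∈ ℝ^m, whose amplitudes tend to √2/j. -/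

import Mathlib

/-- Geodesic distance `D_{0l}` from the `0`-th to the `l`-th of `n` evenly spaced
points on the circle of circumference `2π`: `(2π/n)·min(l, n−l)`. -/
noncomputable def circDist0 (n l : ℕ) : ℝ :=
  (2 * Real.pi / n) * ((min l (n - l) : ℕ) : ℝ)

/-- `λ_j(n) = -(1/2) ∑_{l=0}^{n-1} D_{0l}^2 e^{2πilj/n}`. -/
noncomputable def circEig (n j : ℕ) : ℂ :=
  -(1/2) * ∑ l ∈ Finset.range n, ((circDist0 n l ^ 2 : ℝ) : ℂ) *
    Complex.exp (2 * Real.pi * Complex.I / n) ^ (l * j)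

open Filter Topology in
/-- Left Riemann sums on `[0, 1]` of a continuous function converge to its integral. -/
theorem tendsto_sum_div_integral {f : ℝ → ℝ} (hf : Continuous f) :
    Tendsto (fun n : ℕ => (∑ l ∈ Finset.range n, f (l / n)) / n) atTop
      (𝓝 (∫ x in (0 : ℝ)..1, f x)) := by
  rw [Metric.tendsto_atTop]
  intro ε hε
  have huc := (isCompact_Icc (a := (0 : ℝ)) (b := 1)).uniformContinuousOn_of_continuous
    hf.continuousOn
  rw [Metric.uniformContinuousOn_iff] at huc
  obtain ⟨δ, hδ, h⟩ := huc (ε / 2) (half_pos hε)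
  obtain ⟨N, hN⟩ := exists_nat_gt (1 / δ)
  refine ⟨N + 1, fun n hn => ?_⟩
  have hn0 : (0 : ℝ) < n := by exact_mod_cast (by omega : 0 < n)
  have hnδ : 1 / (n : ℝ) < δ := by
    rw [div_lt_comm₀ hn0 hδ]
    exact hN.trans_le (by exact_mod_cast (by omega : N ≤ n))
  have hsplit : ∫ x in (0 : ℝ)..1, f x =
      ∑ l ∈ Finset.range n, ∫ x in ((l : ℝ) / n)..(((l + 1 : ℕ) : ℝ) / n), f x := by
    rw [intervalIntegral.sum_integral_adjacent_intervals (a := fun l : ℕ => (l : ℝ) / n)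
      fun _ _ => hf.intervalIntegrable _ _]
    simp [hn0.ne']
  have hpiece : ∀ l ∈ Finset.range n,
      ‖f (l / n) / n - ∫ x in ((l : ℝ) / n)..(((l + 1 : ℕ) : ℝ) / n), f x‖ ≤ ε / 2 / n := by
    intro l hl
    have hl' : ((l + 1 : ℕ) : ℝ) ≤ n := by exact_mod_cast Finset.mem_range.mp hl
    have hstep : ((l + 1 : ℕ) : ℝ) / n - l / n = 1 / n := by push_cast; ring
    have hle : (l : ℝ) / n ≤ ((l + 1 : ℕ) : ℝ) / n := by
      have : 0 ≤ 1 / (n : ℝ) := by positivity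
      linarith
    have hle1 : ((l + 1 : ℕ) : ℝ) / n ≤ 1 := (div_le_one hn0).mpr hl'
    have hl0 : 0 ≤ (l : ℝ) / n := by positivity
    have hconst : f (l / n) / n =
        ∫ _ in ((l : ℝ) / n)..(((l + 1 : ℕ) : ℝ) / n), f (l / n) := by
      rw [intervalIntegral.integral_const, hstep, smul_eq_mul]; ring
    rw [hconst, ← intervalIntegral.integral_sub intervalIntegrable_const
      (hf.intervalIntegrable _ _)]
    refine (intervalIntegral.norm_integral_le_of_norm_le_const (C := ε / 2) ?_).trans ?_
    · intro x hx
      rw [Set.uIoc_of_le hle] at hx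
      rw [← dist_eq_norm]
      refine (h _ ⟨hl0, hle.trans hle1⟩ x ⟨hl0.trans hx.1.le, hx.2.trans hle1⟩ ?_).le
      rw [Real.dist_eq, abs_sub_comm, abs_of_nonneg (by linarith [hx.1])]
      linarith [hx.2]
    · rw [hstep, abs_of_nonneg (by positivity)]
      exact le_of_eq (by ring)
  rw [dist_eq_norm, hsplit, Finset.sum_div, ← Finset.sum_sub_distrib]
  calc _ ≤ ∑ _ ∈ Finset.range n, ε / 2 / (n : ℝ) := norm_sum_le_of_le _ hpiece
    _ = ε / 2 := by
      rw [Finset.sum_const, Finset.card_range, nsmul_eq_mul]; field_simp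
    _ < ε := half_lt_self hε

theorem integral_cos_sq_two_pi_mul {j : ℕ} (hj : j ≠ 0) :
    ∫ x in (0 : ℝ)..1, Real.cos (2 * Real.pi * j * x) ^ 2 = 1 / 2 := by
  have hc : 2 * Real.pi * j ≠ 0 := by positivity
  rw [intervalIntegral.integral_comp_mul_left (fun x => Real.cos x ^ 2) hc, integral_cos_sq]
  have hs : Real.sin (2 * Real.pi * j) = 0 := by
    rw [show 2 * Real.pi * j = (2 * j : ℕ) * Real.pi by push_cast; ring, Real.sin_nat_mul_pi]
  simp [hs]
  field_simp

theorem integral_sin_sq_two_pi_mul {j : ℕ} (hj : j ≠ 0) :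
    ∫ x in (0 : ℝ)..1, Real.sin (2 * Real.pi * j * x) ^ 2 = 1 / 2 := by
  have hc : 2 * Real.pi * j ≠ 0 := by positivity
  rw [intervalIntegral.integral_comp_mul_left (fun x => Real.sin x ^ 2) hc, integral_sin_sq]
  have hs : Real.sin (2 * Real.pi * j) = 0 := by
    rw [show 2 * Real.pi * j = (2 * j : ℕ) * Real.pi by push_cast; ring, Real.sin_nat_mul_pi]
  simp [hs]
  field_simp

theorem hasDerivAt_sq_mul_cos_antideriv {c : ℝ} (hc : c ≠ 0) (x : ℝ) :
    HasDerivAt (fun x => x ^ 2 * Real.sin (c * x) / c + 2 * x * Real.cos (c * x) / c ^ 2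
      - 2 * Real.sin (c * x) / c ^ 3) (x ^ 2 * Real.cos (c * x)) x := by
  have hl : HasDerivAt (fun x => c * x) c x := by simpa using (hasDerivAt_id x).const_mul c
  have h2 : HasDerivAt (fun x : ℝ => 2 * x) 2 x := by simpa using (hasDerivAt_id x).const_mul 2
  refine HasDerivAt.congr_deriv (((((hasDerivAt_pow 2 x).mul hl.sin).div_const c).add
    ((h2.mul hl.cos).div_const (c ^ 2))).sub ((hl.sin.const_mul 2).div_const (c ^ 3))) ?_
  push_cast
  field_simp
  ring

/-- The integral of `d(0, 2πx)² cos (2πjx)` over one period, where `d` is the geodesic distance on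
the circle, for odd frequencies `j`. -/
theorem integral_circDist_sq_mul_cos {j : ℕ} (hj : Odd j) :
    ∫ x in (0 : ℝ)..1, (2 * Real.pi * min x (1 - x)) ^ 2 * Real.cos (2 * Real.pi * j * x)
      = -2 / (j : ℝ) ^ 2 := by
  have hj0 : (j : ℝ) ≠ 0 := by exact_mod_cast hj.pos.ne'
  have hc : 2 * Real.pi * j ≠ 0 := by positivity
  have hcont : Continuous fun x : ℝ =>
      (2 * Real.pi * min x (1 - x)) ^ 2 * Real.cos (2 * Real.pi * j * x) := by fun_prop
  set c := 2 * Real.pi * j with hcdef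
  have hhalf : ∫ x in (0 : ℝ)..(1 / 2), (2 * Real.pi * min x (1 - x)) ^ 2 * Real.cos (c * x)
      = -1 / (j : ℝ) ^ 2 := by
    have hcongr : ∫ x in (0 : ℝ)..(1 / 2), (2 * Real.pi * min x (1 - x)) ^ 2 * Real.cos (c * x)
        = ∫ x in (0 : ℝ)..(1 / 2), (2 * Real.pi) ^ 2 * (x ^ 2 * Real.cos (c * x)) := by
      refine intervalIntegral.integral_congr fun x hx => ?_
      rw [Set.uIcc_of_le (by norm_num)] at hx
      simp only [min_eq_left (by linarith [hx.2] : x ≤ 1 - x)]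
      ring
    have hsin : Real.sin (c * (1 / 2)) = 0 := by
      rw [show c * (1 / 2) = j * Real.pi by rw [hcdef]; ring, Real.sin_nat_mul_pi]
    have hcos : Real.cos (c * (1 / 2)) = -1 := by
      rw [show c * (1 / 2) = j * Real.pi by rw [hcdef]; ring, Real.cos_nat_mul_pi, hj.neg_one_pow]
    rw [hcongr, intervalIntegral.integral_const_mul,
      intervalIntegral.integral_eq_sub_of_hasDerivAt
        (fun x _ => hasDerivAt_sq_mul_cos_antideriv hc x)
        (Continuous.intervalIntegrable (by fun_prop) _ _), hsin, hcos]
    simp [hcdef]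
    field_simp
  have hsymm : ∫ x in (1 / 2 : ℝ)..1, (2 * Real.pi * min x (1 - x)) ^ 2 * Real.cos (c * x)
      = ∫ x in (0 : ℝ)..(1 / 2), (2 * Real.pi * min x (1 - x)) ^ 2 * Real.cos (c * x) := by
    have hrefl := intervalIntegral.integral_comp_sub_left (a := 1 / 2) (b := 1)
      (fun x : ℝ => (2 * Real.pi * min x (1 - x)) ^ 2 * Real.cos (c * x)) 1
    rw [show (1 : ℝ) - 1 = 0 by norm_num, show (1 : ℝ) - 1 / 2 = 1 / 2 by norm_num] at hrefl
    rw [← hrefl]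
    refine intervalIntegral.integral_congr fun x _ => ?_
    have hcos : Real.cos (c * (1 - x)) = Real.cos (c * x) := by
      rw [show c * (1 - x) = j * (2 * Real.pi) - c * x by rw [hcdef]; ring,
        Real.cos_nat_mul_two_pi_sub]
    simp only [hcos, sub_sub_cancel, min_comm]
  rw [← intervalIntegral.integral_add_adjacent_intervals (hcont.intervalIntegrable 0 (1 / 2))
    (hcont.intervalIntegrable (1 / 2) 1), hsymm, hhalf]
  ring

theorem circEig_re (n j : ℕ) : (circEig n j).re = -(1 / 2) * ∑ l ∈ Finset.range n,
    (2 * Real.pi * min ((l : ℝ) / n) (1 - l / n)) ^ 2 *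
      Real.cos (2 * Real.pi * j * (l / n)) := by
  have hre : (circEig n j).re = -(1 / 2) * (∑ l ∈ Finset.range n,
      ((circDist0 n l ^ 2 : ℝ) : ℂ) *
        Complex.exp (2 * Real.pi * Complex.I / n) ^ (l * j)).re := by
    rw [circEig, show (-(1 / 2) : ℂ) = ((-(1 / 2) : ℝ) : ℂ) by push_cast; ring,
      Complex.re_ofReal_mul]
  rw [hre, Complex.re_sum]
  congr 1
  refine Finset.sum_congr rfl fun l hl => ?_
  have hln : l ≤ n := (Finset.mem_range.mp hl).le
  have hn : (0 : ℝ) < n := by exact_mod_cast (Nat.zero_le l).trans_lt (Finset.mem_range.mp hl)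
  rw [Complex.re_ofReal_mul, ← Complex.exp_nat_mul,
    show ((l * j : ℕ) : ℂ) * (2 * Real.pi * Complex.I / n)
      = ((2 * Real.pi * j * (l / n) : ℝ) : ℂ) * Complex.I by push_cast; ring,
    Complex.exp_ofReal_mul_I_re]
  congr 2
  rw [circDist0, Nat.cast_min, Nat.cast_sub hln,
    show (1 : ℝ) - l / n = (n - l) / n by field_simp, min_div_div_right hn.le]
  ring

open Filter Topology in
theorem tendsto_circEig_re_div {j : ℕ} (hj : Odd j) :
    Tendsto (fun n : ℕ => (circEig n j).re / n) atTop (𝓝 (1 / (j : ℝ) ^ 2)) := by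
  have hlim := (tendsto_sum_div_integral (f := fun x : ℝ =>
    (2 * Real.pi * min x (1 - x)) ^ 2 * Real.cos (2 * Real.pi * j * x))
    (by fun_prop)).const_mul (-(1 / 2))
  rw [integral_circDist_sq_mul_cos hj,
    show -(1 / 2) * (-2 / (j : ℝ) ^ 2) = 1 / (j : ℝ) ^ 2 by ring] at hlim
  refine hlim.congr fun n => ?_
  rw [circEig_re, mul_div_assoc]

open Filter Topology in
theorem tendsto_sqrt_circEig_div_sqrt {j : ℕ} (hj : Odd j) {s : ℕ → ℝ}
    (hs : Tendsto (fun n => s n / n) atTop (𝓝 (1 / 2))) :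
    Tendsto (fun n => Real.sqrt ((circEig n j).re) / Real.sqrt (s n)) atTop
      (𝓝 (Real.sqrt 2 / j)) := by
  have hlim := (tendsto_circEig_re_div hj).sqrt.div hs.sqrt (by simp)
  have hval : Real.sqrt (1 / (j : ℝ) ^ 2) / Real.sqrt (1 / 2) = Real.sqrt 2 / j := by
    rw [Real.sqrt_div zero_le_one, Real.sqrt_div zero_le_one, Real.sqrt_sq j.cast_nonneg,
      Real.sqrt_one]
    field_simp
  rw [hval] at hlim
  refine hlim.congr' ?_
  filter_upwards [eventually_gt_atTop 0] with n hn
  have hn' : Real.sqrt n ≠ 0 := (Real.sqrt_pos.mpr (by exact_mod_cast hn)).ne'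
  simp only [Pi.div_apply]
  rw [Real.sqrt_div' _ n.cast_nonneg, Real.sqrt_div' _ n.cast_nonneg, div_div_div_cancel_right₀ hn']

theorem statement12 (j : ℕ) (hjodd : Odd j) (hjpos : 1 ≤ j) :
    Filter.Tendsto (fun n : ℕ => Real.sqrt ((circEig n j).re) /
        Real.sqrt (∑ l ∈ Finset.range n, Real.cos (2 * Real.pi * j * l / n) ^ 2))
      Filter.atTop (nhds (Real.sqrt 2 / j)) ∧
    Filter.Tendsto (fun n : ℕ => Real.sqrt ((circEig n j).re) /
        Real.sqrt (∑ l ∈ Finset.range n, Real.sin (2 * Real.pi * j * l / n) ^ 2))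
      Filter.atTop (nhds (Real.sqrt 2 / j)) := by
  have hj0 : j ≠ 0 := Nat.one_le_iff_ne_zero.mp hjpos
  constructor <;> refine tendsto_sqrt_circEig_div_sqrt hjodd ?_
  · rw [← integral_cos_sq_two_pi_mul hj0]
    simpa only [mul_div_assoc] using tendsto_sum_div_integral
      (f := fun x => Real.cos (2 * Real.pi * j * x) ^ 2) (by fun_prop)
  · rw [← integral_sin_sq_two_pi_mul hj0]
    simpa only [mul_div_assoc] using tendsto_sum_div_integral
      (f := fun x => Real.sin (2 * Real.pi * j * x) ^ 2) (by fun_prop)
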